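/- Let ι be a finite type, S : ι → Type a family of state spaces, prec a relation on ι whose transitive closure is irreflexive, and u a family of update functions that is local with respect to prec. Let x* be a global state satisfying x* i = u i x* for every i. Then for every initial global state x₀ and every topological sort ℓ of prec, the full pass along ℓ from x₀ equals x*: List.foldl (fun x i => step i x) x₀ ℓ = x*. In particular the outcome of a full pass is independent of both the initial state and the chosen topological sort. -/

import Mathlib

/-- A family of update functions is local w.r.t. `prec`: the update of node `i`
depends only on the components `x j` with `prec j i`. -/
def IsLocal {ι : Type*} {S : ι → Type*} (prec : ι → ι → Prop)
    (u : ∀ i, (∀ j, S j) → S i) : Prop :=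
  ∀ i (x y : ∀ j, S j), (∀ j, prec j i → x j = y j) → u i x = u i y

/-- The step function of node `i`: replace the `i`-th component of the global
state by `u i x`, leaving all other components unchanged. -/
def step {ι : Type*} [DecidableEq ι] {S : ι → Type*}
    (u : ∀ i, (∀ j, S j) → S i) (i : ι) (x : ∀ j, S j) : ∀ j, S j :=
  Function.update x i (u i x)

/-- A list `ℓ` is a topological sort of `prec`: it contains every element of
`ι` exactly once, and whenever the transitive closure of `prec` relates `a` to
`b`, `a` occurs before `b` in `ℓ`. -/
def IsTopoSort {ι : Type*} [Fintype ι] [DecidableEq ι]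
    (prec : ι → ι → Prop) (ℓ : List ι) : Prop :=
  (∀ i : ι, ℓ.count i = 1) ∧
  ∀ a b : ι, Relation.TransGen prec a b → [a, b].Sublist ℓ

theorem List.Nodup.not_pair_sublist_swap {α : Type*} {l : List α} (hl : l.Nodup) {a b : α}
    (hab : [a, b].Sublist l) : ¬ [b, a].Sublist l := by
  intro hba
  induction l with
  | nil => cases hab
  | cons c t ih =>
    obtain ⟨hc, ht⟩ := List.nodup_cons.mp hl
    cases hab with
    | cons _ hab =>
      cases hba with
      | cons _ hba => exact ih ht hab hba
      | cons_cons _ hba => exact hc (hab.subset (by simp))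
    | cons_cons _ hab =>
      cases hba with
      | cons _ hba => exact hc (hba.subset (by simp))
      | cons_cons _ hba => exact hc (hba.subset (by simp))

theorem IsTopoSort.pairwise_not_prec {ι : Type*} [Fintype ι] [DecidableEq ι]
    {prec : ι → ι → Prop} {ℓ : List ι} (hℓ : IsTopoSort prec ℓ) :
    ℓ.Pairwise fun a b => ¬ prec b a := by
  have hnodup : ℓ.Nodup := List.nodup_iff_count_le_one.mpr fun i => (hℓ.1 i).le
  exact List.pairwise_iff_forall_sublist.mpr fun hab hba =>
    hnodup.not_pair_sublist_swap hab (hℓ.2 _ _ (.single hba))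

theorem IsLocal.foldl_step_eq {ι : Type*} [DecidableEq ι] {S : ι → Type*}
    {prec : ι → ι → Prop} {u : ∀ i, (∀ j, S j) → S i} (hloc : IsLocal prec u)
    (hirr : ∀ i, ¬ prec i i) {y : ∀ j, S j} (hy : ∀ i, y i = u i y) {l : List ι}
    (hl : l.Pairwise fun a b => ¬ prec b a) {x : ∀ j, S j} (hx : ∀ i, i ∉ l → x i = y i) :
    List.foldl (fun x i => step u i x) x l = y := by
  induction l generalizing x with
  | nil => exact funext fun i => hx i List.not_mem_nil
  | cons a t ih =>
    obtain ⟨ha, ht⟩ := List.pairwise_cons.mp hl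
    refine ih ht fun i hi => ?_
    by_cases hia : i = a
    · subst hia
      rw [hy i]
      refine (Function.update_self i (u i x) x).trans ?_
      refine hloc i x y fun j hj => hx j fun hmem => ?_
      rcases List.mem_cons.mp hmem with rfl | hjt
      · exact hirr _ hj
      · exact ha j hjt hj
    · refine (Function.update_of_ne hia (u a x) x).trans ?_
      exact hx i (by simp [hia, hi])

/-- A full pass along any topological sort, from any initial state, lands on
the fixed point `x*`. -/
theorem pass_eq_fixed_point {ι : Type*} [Fintype ι] [DecidableEq ι]
    {S : ι → Type*} (prec : ι → ι → Prop)
    (hdag : Irreflexive (Relation.TransGen prec))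
    (u : ∀ i, (∀ j, S j) → S i) (hloc : IsLocal prec u)
    (xstar : ∀ j, S j) (hfix : ∀ i, xstar i = u i xstar)
    (x₀ : ∀ j, S j) (ℓ : List ι) (hℓ : IsTopoSort prec ℓ) :
    List.foldl (fun x i => step u i x) x₀ ℓ = xstar := by
  refine hloc.foldl_step_eq (fun i hi => hdag i (.single hi)) hfix hℓ.pairwise_not_prec
    fun i hi => absurd (List.count_pos_iff.mp ?_) hi
  rw [hℓ.1 i]
  exact Nat.one_pos
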